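/- arXiv:2605.25084 — 5 statements merged into one kernel-verified Lean document; each statement's English description precedes it below -/
import Mathlib

section
/- For all integers n ≥ 0 and m ≥ 0 and all t ≥ 0, the coefficient functions satisfy |a_n^{(m)}(t)| ≤ M F^{n−1} G H_{n,m}, where a_n^{(m)} denotes the m-th derivative of a_n. -/
/-- Hockey-stick identity in factorial form. -/
theorem sum_choose_mul_factorial (n m : ℕ) :
    (n + 1) * ∑ k ∈ Finset.range (m + 1), m.choose k * (k.factorial * (n + (m - k)).factorial) =
      (n + m + 1).factorial := by
  have h : ∀ k ∈ Finset.range (m + 1), m.choose k * (k.factorial * (n + (m - k)).factorial) =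
      m.factorial * n.factorial * ((m - k) + n).choose n := by
    intro k hk
    have hk' : k ≤ m := Nat.lt_succ_iff.mp (Finset.mem_range.mp hk)
    have h1 := Nat.choose_mul_factorial_mul_factorial hk'
    have h2 := Nat.add_choose_mul_factorial_mul_factorial (m - k) n
    rw [add_comm n (m - k), ← h2, ← h1]
    ring
  have h3 : (∑ k ∈ Finset.range (m + 1), ((m - k) + n).choose n) = (m + n + 1).choose (n + 1) := by
    rw [← Nat.sum_range_add_choose m n, ← Finset.sum_range_reflect]
    refine Finset.sum_congr rfl fun k hk => ?_
    have := Finset.mem_range.mp hk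
    congr 1
    omega
  rw [Finset.sum_congr rfl h, ← Finset.mul_sum, h3]
  have h4 := Nat.add_choose_mul_factorial_mul_factorial m (n + 1)
  rw [Nat.factorial_succ n, ← add_assoc] at h4
  rw [add_comm n m, ← h4]
  ring

theorem rpow_mul_sum_choose_mul_factorial_rpow_le {d : ℝ} (hd : 1 ≤ d) (n m : ℕ) :
    ((n : ℝ) + 1) ^ d * ∑ k ∈ Finset.range (m + 1),
        (m.choose k : ℝ) * ((k.factorial : ℝ) ^ d * ((n + (m - k)).factorial : ℝ) ^ d) ≤
      ((n + m + 1).factorial : ℝ) ^ d := by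
  have split : ∀ x : ℝ, 0 < x → x ^ d = x ^ (d - 1) * x := fun x hx => by
    rw [← Real.rpow_add_one hx.ne', sub_add_cancel]
  have hy : (0 : ℝ) < (n + m + 1).factorial := by positivity
  have hsum : ((n : ℝ) + 1) * ∑ k ∈ Finset.range (m + 1),
      (m.choose k : ℝ) * ((k.factorial : ℝ) * ((n + (m - k)).factorial : ℝ)) =
      ((n + m + 1).factorial : ℝ) := by exact_mod_cast sum_choose_mul_factorial n m
  calc
    _ = ∑ k ∈ Finset.range (m + 1), (m.choose k : ℝ) *
          (((n : ℝ) + 1) * (k.factorial * (n + (m - k)).factorial)) ^ d := by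
      rw [Finset.mul_sum]
      refine Finset.sum_congr rfl fun k _ => ?_
      rw [Real.mul_rpow (by positivity) (by positivity),
        Real.mul_rpow (by positivity) (by positivity)]
      ring
    _ ≤ ∑ k ∈ Finset.range (m + 1), (m.choose k : ℝ) * (((n + m + 1).factorial : ℝ) ^ (d - 1) *
          (((n : ℝ) + 1) * (k.factorial * (n + (m - k)).factorial))) := by
      refine Finset.sum_le_sum fun k hk => ?_
      have hk' : k ≤ m := Nat.lt_succ_iff.mp (Finset.mem_range.mp hk)
      have hx : ((n : ℝ) + 1) * (k.factorial * (n + (m - k)).factorial) ≤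
          (n + m + 1).factorial := by
        have h1 : k.factorial * (n + (m - k)).factorial ≤ (n + m).factorial := by
          have := Nat.factorial_mul_factorial_dvd_factorial_add k (n + (m - k))
          rw [show k + (n + (m - k)) = n + m by omega] at this
          exact Nat.le_of_dvd (Nat.factorial_pos _) this
        have h2 : (n + 1) * (k.factorial * (n + (m - k)).factorial) ≤ (n + m + 1).factorial := by
          rw [Nat.factorial_succ]
          exact Nat.mul_le_mul (by omega) h1
        exact_mod_cast h2
      rw [split _ (by positivity)]
      gcongr
    _ = ((n + m + 1).factorial : ℝ) ^ (d - 1) * (((n : ℝ) + 1) * ∑ k ∈ Finset.range (m + 1),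
          (m.choose k : ℝ) * ((k.factorial : ℝ) * ((n + (m - k)).factorial : ℝ))) := by
      rw [Finset.mul_sum, Finset.mul_sum]
      exact Finset.sum_congr rfl fun k _ => by ring
    _ = _ := by rw [hsum, ← split _ hy]

/-- The weight `H_{n,m}` of the Gevrey estimates for the coefficient functions. -/
noncomputable def gevreyWeight (R d : ℝ) (n m : ℕ) : ℝ :=
  ((n + m).factorial : ℝ) ^ d / (R ^ (n + m) * (n.factorial : ℝ) ^ (d - 1))

theorem gevreyWeight_nonneg {R : ℝ} (hR : 0 < R) (d : ℝ) (n m : ℕ) :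
    0 ≤ gevreyWeight R d n m := by
  unfold gevreyWeight
  positivity

theorem gevreyWeight_succ_right_le {R d : ℝ} (hR : 0 < R) (hd : 1 ≤ d) (hd' : d ≤ 2) (n m : ℕ) :
    gevreyWeight R d n (m + 1) ≤ R * gevreyWeight R d (n + 2) m := by
  unfold gevreyWeight
  have e : n + 2 + m = (n + (m + 1)) + 1 := by omega
  rw [e, Nat.factorial_succ (n + (m + 1)), Nat.factorial_succ (n + 1), Nat.factorial_succ n]
  push_cast
  rw [Real.mul_rpow (by positivity) (by positivity), Real.mul_rpow (by positivity) (by positivity),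
    Real.mul_rpow (by positivity) (by positivity), pow_succ]
  have key : ((n : ℝ) + 1 + 1) ^ (d - 1) * ((n : ℝ) + 1) ^ (d - 1) ≤
      ((n : ℝ) + ((m : ℝ) + 1) + 1) ^ d := by
    calc
      _ ≤ ((n : ℝ) + 1 + 1) ^ (d - 1) * ((n : ℝ) + 1 + 1) := by
        gcongr
        calc ((n : ℝ) + 1) ^ (d - 1) ≤ ((n : ℝ) + 1) ^ (1 : ℝ) :=
              Real.rpow_le_rpow_of_exponent_le (by linarith [Nat.cast_nonneg (α := ℝ) n])
                (by linarith)
          _ ≤ _ := by rw [Real.rpow_one]; linarith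
      _ = ((n : ℝ) + 1 + 1) ^ d := by
        rw [← Real.rpow_add_one (by positivity), sub_add_cancel]
      _ ≤ _ := by
        gcongr
        linarith [Nat.cast_nonneg (α := ℝ) m]
  rw [mul_div_assoc', div_le_div_iff₀ (by positivity) (by positivity)]
  calc
    _ = (((n : ℝ) + 1 + 1) ^ (d - 1) * ((n : ℝ) + 1) ^ (d - 1)) *
        (((n + (m + 1)).factorial : ℝ) ^ d * R ^ (n + (m + 1)) * R *
          (n.factorial : ℝ) ^ (d - 1)) := by ring
    _ ≤ ((n : ℝ) + ((m : ℝ) + 1) + 1) ^ d *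
        (((n + (m + 1)).factorial : ℝ) ^ d * R ^ (n + (m + 1)) * R *
          (n.factorial : ℝ) ^ (d - 1)) := by gcongr
    _ = _ := by ring

theorem sum_choose_mul_gevreyWeight_le {R d : ℝ} (hR : 0 < R) (hd : 1 ≤ d) (n m : ℕ) :
    ∑ k ∈ Finset.range (m + 1), (m.choose k : ℝ) * ((k.factorial : ℝ) ^ d / R ^ k) *
        gevreyWeight R d (n + 1) (m - k) ≤ R / 2 * gevreyWeight R d (n + 2) m := by
  have hS := rpow_mul_sum_choose_mul_factorial_rpow_le hd (n + 1) m
  set S := ∑ k ∈ Finset.range (m + 1),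
    (m.choose k : ℝ) * ((k.factorial : ℝ) ^ d * ((n + 1 + (m - k)).factorial : ℝ) ^ d)
  have hS0 : 0 ≤ S := Finset.sum_nonneg fun k _ => by positivity
  have hsum : ∑ k ∈ Finset.range (m + 1), (m.choose k : ℝ) * ((k.factorial : ℝ) ^ d / R ^ k) *
      gevreyWeight R d (n + 1) (m - k) =
      S / (R ^ (n + 1 + m) * ((n + 1).factorial : ℝ) ^ (d - 1)) := by
    rw [Finset.sum_div]
    refine Finset.sum_congr rfl fun k hk => ?_
    have hk' : k ≤ m := Nat.lt_succ_iff.mp (Finset.mem_range.mp hk)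
    have e : R ^ (n + 1 + m) = R ^ k * R ^ (n + 1 + (m - k)) := by
      rw [← pow_add]
      congr 1
      omega
    rw [gevreyWeight, e]
    field_simp
  rw [hsum, gevreyWeight, Nat.factorial_succ (n + 1), show n + 2 + m = n + 1 + m + 1 by omega,
    pow_succ, mul_div_assoc', div_le_div_iff₀ (by positivity) (by positivity)]
  push_cast at hS ⊢
  rw [Real.mul_rpow (by positivity) (by positivity)]
  have h2 : 2 * ((n : ℝ) + 1 + 1) ^ (d - 1) ≤ ((n : ℝ) + 1 + 1) ^ d := by
    calc
      _ ≤ ((n : ℝ) + 1 + 1) * ((n : ℝ) + 1 + 1) ^ (d - 1) := by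
        gcongr
        linarith [Nat.cast_nonneg (α := ℝ) n]
      _ = _ := by rw [mul_comm, ← Real.rpow_add_one (by positivity), sub_add_cancel]
  have h3 : 2 * ((n : ℝ) + 1 + 1) ^ (d - 1) * S ≤ ((n + 1 + m + 1).factorial : ℝ) ^ d :=
    (mul_le_mul_of_nonneg_right h2 hS0).trans hS
  calc
    _ = R / 2 * (2 * ((n : ℝ) + 1 + 1) ^ (d - 1) * S) *
        (R ^ (n + 1 + m) * ((n + 1).factorial : ℝ) ^ (d - 1)) := by ring
    _ ≤ R / 2 * ((n + 1 + m + 1).factorial : ℝ) ^ d *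
        (R ^ (n + 1 + m) * ((n + 1).factorial : ℝ) ^ (d - 1)) := by gcongr
    _ = _ := by ring

/-- The growth factor is the positive root of `α x² = R M x / 2 + R`. -/
theorem growth_factor_quadratic {α M R F : ℝ} (hα : 0 < α) (hR : 0 < R)
    (hF : F = (R * M + Real.sqrt (R ^ 2 * M ^ 2 + 16 * α * R)) / (4 * α)) :
    α * F ^ 2 = R + R * M / 2 * F := by
  have hs := Real.sq_sqrt (show 0 ≤ R ^ 2 * M ^ 2 + 16 * α * R by positivity)
  have h : Real.sqrt (R ^ 2 * M ^ 2 + 16 * α * R) = 4 * α * F - R * M := by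
    rw [hF]
    field_simp
    ring
  rw [h] at hs
  have : 16 * α * (α * F ^ 2) = 16 * α * (R + R * M / 2 * F) := by linear_combination hs
  exact mul_left_cancel₀ (by positivity) this


/-- For all integers `n ≥ 0`, `m ≥ 0` and all `t ≥ 0`, the coefficient
functions of the series solution of the inverse Stefan problem satisfy
`|a_n^{(m)}(t)| ≤ M F^(n-1) G H_{n,m}`. -/
theorem coefficient_bounds
    (α β ε M R d : ℝ)
    (hα : 0 < α) (hβ : 0 < β) (hε : 0 < ε) (hM : 0 < M) (hR : 0 < R)
    (hd : d ∈ Set.Icc (1 : ℝ) 2)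
    (s_r : ℝ → ℝ) (hs : ContDiff ℝ (⊤ : ℕ∞) s_r)
    (hGevrey : ∀ (m : ℕ) (t : ℝ), 0 ≤ t →
      |iteratedDeriv (m + 1) s_r t| ≤ M * (m.factorial : ℝ) ^ d / R ^ m)
    (a : ℕ → ℝ → ℝ)
    (ha0 : ∀ t : ℝ, a 0 t = 0)
    (ha1 : ∀ t : ℝ, a 1 t = -(ε * iteratedDeriv 2 s_r t + deriv s_r t) / β)
    (haRec : ∀ n : ℕ, 2 ≤ n → ∀ t : ℝ,
      a n t = (deriv (a (n - 2)) t - deriv s_r t * a (n - 1) t) / α)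
    (G F : ℝ)
    (hG : G = (ε + R) / β)
    (hF : F = (R * M + Real.sqrt (R ^ 2 * M ^ 2 + 16 * α * R)) / (4 * α))
    (H : ℕ → ℕ → ℝ)
    (hH : ∀ n m : ℕ,
      H n m = ((n + m).factorial : ℝ) ^ d / (R ^ (n + m) * (n.factorial : ℝ) ^ (d - 1))) :
    ∀ (n m : ℕ) (t : ℝ), 0 ≤ t →
      |iteratedDeriv m (a n) t| ≤ M * F ^ ((n : ℤ) - 1) * G * H n m := by
  have hs' : ContDiff ℝ (⊤ : ℕ∞) (deriv s_r) := (contDiff_infty_iff_deriv.mp hs).2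
  have hs'' : ContDiff ℝ (⊤ : ℕ∞) (deriv (deriv s_r)) := (contDiff_infty_iff_deriv.mp hs').2
  have hR2 : iteratedDeriv 2 s_r = deriv (deriv s_r) := by
    rw [iteratedDeriv_succ, iteratedDeriv_one]
  have hd1 : ∀ m, iteratedDeriv m (deriv s_r) = iteratedDeriv (m + 1) s_r := fun m =>
    iteratedDeriv_succ'.symm
  have hd2 : ∀ m, iteratedDeriv m (deriv (deriv s_r)) = iteratedDeriv (m + 1 + 1) s_r := fun m => by
    rw [← iteratedDeriv_succ', hd1]
  have f0 : a 0 = fun _ => 0 := funext ha0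
  have f1 : a 1 = fun t => (-1 / β) * (ε * deriv (deriv s_r) t + deriv s_r t) := by
    funext t
    rw [ha1, hR2]
    ring
  have f2 : ∀ n, a (n + 2) =
      fun t => (1 / α) * (deriv (a n) t - deriv s_r t * a (n + 1) t) := fun n => by
    funext t
    rw [haRec (n + 2) (by omega)]
    simp only [Nat.add_sub_cancel, show n + 2 - 1 = n + 1 by omega]
    ring
  have smooth : ∀ n, ContDiff ℝ (⊤ : ℕ∞) (a n) := by
    intro n
    induction n using Nat.twoStepInduction with
    | zero => rw [f0]; exact contDiff_const
    | one =>
      rw [f1]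
      exact contDiff_const.mul ((contDiff_const.mul hs'').add hs')
    | more n h0 h1 =>
      rw [f2]
      exact contDiff_const.mul ((contDiff_infty_iff_deriv.mp h0).2.sub (hs'.mul h1))
  have at_order : ∀ {f : ℝ → ℝ}, ContDiff ℝ (⊤ : ℕ∞) f → ∀ (m : ℕ) (t : ℝ),
      ContDiffAt ℝ m f t := fun hf m _ => (contDiff_infty.mp hf m).contDiffAt
  have hG0 : 0 < G := by rw [hG]; positivity
  have hF0 : 0 < F := by rw [hF]; positivity
  have hquad := growth_factor_quadratic hα hR hF
  obtain rfl : H = gevreyWeight R d := by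
    funext n m
    exact hH n m
  intro n
  induction n using Nat.twoStepInduction with
  | zero =>
    intro m t _
    have h0 : iteratedDeriv m (a 0) t = 0 := by rw [f0]; simp
    rw [h0, abs_zero]
    have := gevreyWeight_nonneg hR d 0 m
    positivity
  | one =>
    intro m t ht
    have hm : iteratedDeriv m (a 1) t = (-1 / β) *
        (ε * iteratedDeriv (m + 1 + 1) s_r t + iteratedDeriv (m + 1) s_r t) := by
      rw [f1, iteratedDeriv_const_mul_field, iteratedDeriv_fun_add
        (at_order (contDiff_const.mul hs'') m t) (at_order hs' m t),
        iteratedDeriv_const_mul_field, hd1, hd2]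
    have b1 := hGevrey (m + 1) t ht
    have b2 : |iteratedDeriv (m + 1) s_r t| ≤
        R * (M * ((m + 1).factorial : ℝ) ^ d / R ^ (m + 1)) := by
      refine (hGevrey m t ht).trans ?_
      have hle : (m.factorial : ℝ) ^ d ≤ ((m + 1).factorial : ℝ) ^ d :=
        Real.rpow_le_rpow (by positivity)
          (by exact_mod_cast Nat.factorial_le (Nat.le_succ m)) (by linarith [hd.1])
      calc
        _ ≤ M * ((m + 1).factorial : ℝ) ^ d / R ^ m := by gcongr
        _ = _ := by rw [pow_succ]; field_simp
    have hw : gevreyWeight R d 1 m = ((m + 1).factorial : ℝ) ^ d / R ^ (m + 1) := by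
      simp [gevreyWeight, add_comm 1 m]
    have habs : |(-1 / β : ℝ)| = 1 / β := by
      rw [abs_div, abs_neg, abs_one, abs_of_pos hβ]
    rw [hm, abs_mul, habs, hw, hG]
    calc
      _ ≤ 1 / β * (ε * (M * ((m + 1).factorial : ℝ) ^ d / R ^ (m + 1)) +
          R * (M * ((m + 1).factorial : ℝ) ^ d / R ^ (m + 1))) := by
        gcongr
        refine (abs_add_le _ _).trans (add_le_add ?_ b2)
        rw [abs_mul, abs_of_pos hε]
        gcongr
      _ = _ := by
        simp
        ring
  | more n h0 h1 =>
    intro m t ht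
    have hm : iteratedDeriv m (a (n + 2)) t = (1 / α) * (iteratedDeriv (m + 1) (a n) t -
        ∑ k ∈ Finset.range (m + 1), (m.choose k : ℝ) * iteratedDeriv (k + 1) s_r t *
          iteratedDeriv (m - k) (a (n + 1)) t) := by
      rw [f2, iteratedDeriv_const_mul_field, iteratedDeriv_fun_sub
        (at_order (contDiff_infty_iff_deriv.mp (smooth n)).2 m t)
        (at_order (hs'.mul (smooth (n + 1))) m t), ← iteratedDeriv_succ',
        iteratedDeriv_fun_mul (at_order hs' m t) (at_order (smooth (n + 1)) m t)]
      simp only [hd1]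
    set u := M * F ^ ((n : ℤ) - 1) * G with hu
    have hu0 : 0 < u := by positivity
    have z1 : M * F ^ (((n + 1 : ℕ) : ℤ) - 1) * G = u * F := by
      rw [show (((n + 1 : ℕ) : ℤ) - 1) = (n : ℤ) - 1 + 1 by push_cast; ring,
        zpow_add_one₀ hF0.ne', hu]
      ring
    have z2 : M * F ^ (((n + 2 : ℕ) : ℤ) - 1) * G = u * F ^ 2 := by
      rw [show (((n + 2 : ℕ) : ℤ) - 1) = (n : ℤ) - 1 + 1 + 1 by push_cast; ring,
        zpow_add_one₀ hF0.ne', zpow_add_one₀ hF0.ne', hu]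
      ring
    rw [z1] at h1
    rw [z2, hm, abs_mul, abs_of_pos (show 0 < 1 / α by positivity)]
    have b0 : |iteratedDeriv (m + 1) (a n) t| ≤ u * (R * gevreyWeight R d (n + 2) m) :=
      (h0 (m + 1) t ht).trans
        (mul_le_mul_of_nonneg_left (gevreyWeight_succ_right_le hR hd.1 hd.2 n m) hu0.le)
    have b1 : |∑ k ∈ Finset.range (m + 1), (m.choose k : ℝ) * iteratedDeriv (k + 1) s_r t *
        iteratedDeriv (m - k) (a (n + 1)) t| ≤
        M * (u * F) * (R / 2 * gevreyWeight R d (n + 2) m) := by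
      calc
        _ ≤ ∑ k ∈ Finset.range (m + 1), M * (u * F) * ((m.choose k : ℝ) *
            ((k.factorial : ℝ) ^ d / R ^ k) * gevreyWeight R d (n + 1) (m - k)) := by
          refine (Finset.abs_sum_le_sum_abs _ _).trans (Finset.sum_le_sum fun k _ => ?_)
          rw [abs_mul, abs_mul, Nat.abs_cast]
          calc
            _ ≤ (m.choose k : ℝ) * (M * (k.factorial : ℝ) ^ d / R ^ k) *
                (u * F * gevreyWeight R d (n + 1) (m - k)) := by
              gcongr
              · exact hGevrey k t ht
              · exact h1 (m - k) t ht
            _ = _ := by ring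
        _ ≤ _ := by
          rw [← Finset.mul_sum]
          exact mul_le_mul_of_nonneg_left (sum_choose_mul_gevreyWeight_le hR hd.1 n m)
            (by positivity)
    calc
      _ ≤ 1 / α * (u * (R * gevreyWeight R d (n + 2) m) +
          M * (u * F) * (R / 2 * gevreyWeight R d (n + 2) m)) := by
        gcongr
        exact (abs_sub _ _).trans (add_le_add b0 b1)
      _ = 1 / α * (u * (R + R * M / 2 * F) * gevreyWeight R d (n + 2) m) := by ring
      _ = _ := by
        rw [← hquad]
        field_simp
end

section
/- If E(0) ≤ E_r(0) + (1/c) q_r(t) e^{ct} for all t ≥ 0, then the energy-shaping control input q_c(t) := q_r(t) − c (E(t) − E_r(t)) satisfies q_c(t) ≥ 0 for all t ≥ 0. If moreover E_r(t) + (E(0) − E_r(0)) e^{−ct} < (k/β) s̄_r for all t ≥ 0, then E(t) < (k/β) s̄_r for all t ≥ 0. -/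
/-- A solution of `y' = -c y` on `[0, ∞)` is `y 0 * exp (-c t)`. -/
lemma eq_mul_exp_of_hasDerivAt_neg_mul {c : ℝ} {y : ℝ → ℝ}
    (hy : ∀ t, 0 ≤ t → HasDerivAt y (-c * y t) t) {t : ℝ} (ht : 0 ≤ t) :
    y t = y 0 * Real.exp (-c * t) := by
  have hderiv : ∀ x, 0 ≤ x → HasDerivAt (fun s => y s * Real.exp (c * s)) 0 x := by
    intro x hx
    have hexp : HasDerivAt (fun s => Real.exp (c * s)) (Real.exp (c * x) * (c * 1)) x :=
      ((hasDerivAt_id x).const_mul c).exp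
    exact ((hy x hx).mul hexp).congr_deriv (by ring)
  have hconst := constant_of_has_deriv_right_zero
    (fun x hx => (hderiv x hx.1).continuousAt.continuousWithinAt)
    (fun x hx => (hderiv x hx.1).hasDerivWithinAt) t ⟨ht, le_rfl⟩
  simp only [mul_zero, Real.exp_zero, mul_one] at hconst
  rw [← hconst, mul_assoc, ← Real.exp_add]
  simp

/-- If `E(0) ≤ E_r(0) + (1/c) q_r(t) e^{ct}` for all `t ≥ 0`, then the
energy-shaping control input `q_c(t) = q_r(t) − c(E(t) − E_r(t))` is non-negative for all
`t ≥ 0`.  If moreover `E_r(t) + (E(0) − E_r(0)) e^{−ct} < (k/β) s̄_r` for all `t ≥ 0`,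
then `E(t) < (k/β) s̄_r` for all `t ≥ 0`. -/
theorem safety_of_energy_shaping_control
    (c k β sbar_r : ℝ) (hc : 0 < c) (hk : 0 < k) (hβ : 0 < β)
    (q_r : ℝ → ℝ)
    (E E_r : ℝ → ℝ) (hE : Differentiable ℝ E) (hEr : Differentiable ℝ E_r)
    (hEr_ode : ∀ t : ℝ, 0 ≤ t → deriv E_r t = q_r t)
    (hE_ode : ∀ t : ℝ, 0 ≤ t → deriv E t = q_r t - c * (E t - E_r t))
    (h1 : ∀ t : ℝ, 0 ≤ t → E 0 ≤ E_r 0 + (1 / c) * q_r t * Real.exp (c * t)) :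
    (∀ t : ℝ, 0 ≤ t → 0 ≤ q_r t - c * (E t - E_r t)) ∧
    ((∀ t : ℝ, 0 ≤ t → E_r t + (E 0 - E_r 0) * Real.exp (-c * t) < (k / β) * sbar_r) →
      ∀ t : ℝ, 0 ≤ t → E t < (k / β) * sbar_r) := by
  have hsol : ∀ t : ℝ, 0 ≤ t → E t - E_r t = (E 0 - E_r 0) * Real.exp (-c * t) := by
    intro t ht
    refine eq_mul_exp_of_hasDerivAt_neg_mul (y := fun s => E s - E_r s) (fun s hs => ?_) ht
    refine ((hE s).hasDerivAt.sub (hEr s).hasDerivAt).congr_deriv ?_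
    rw [hE_ode s hs, hEr_ode s hs]
    ring
  refine ⟨fun t ht => ?_, fun h t ht => ?_⟩
  · have hle : E 0 - E_r 0 ≤ 1 / c * q_r t * Real.exp (c * t) := by linarith [h1 t ht]
    have hexp : Real.exp (c * t) * Real.exp (-c * t) = 1 := by
      rw [← Real.exp_add]
      simp
    rw [hsol t ht, sub_nonneg]
    calc c * ((E 0 - E_r 0) * Real.exp (-c * t))
        ≤ c * (1 / c * q_r t * Real.exp (c * t) * Real.exp (-c * t)) := by gcongr
      _ = c * (1 / c) * q_r t * (Real.exp (c * t) * Real.exp (-c * t)) := by ring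
      _ = q_r t := by rw [hexp, mul_one_div_cancel hc.ne', one_mul, mul_one]
  · linarith [h t ht, hsol t ht]
end

section
/- The symmetric 2×2 real matrix P with entries p₁₂ = p₂₁ = λε/(2c), p₂₂ = (λε/2)(ε/c + κ)/(1 + cε), and p₁₁ = p₁₂(1 + cε)/ε + c p₂₂/ε is positive definite, satisfies the Lyapunov equation P(A + BK) + (A + BK)ᵀP = −Q, and the vector D := −(2/α) P B equals (λβ/α)[1/c, ε/(c(1 + cε)) + κ/(1 + cε)]ᵀ. -/
open Matrix

theorem posDef_fin_two_of_pos_of_sq_lt {a b d : ℝ} (ha : 0 < a) (hdet : b ^ 2 < a * d) :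
    (!![a, b; b, d] : Matrix (Fin 2) (Fin 2) ℝ).PosDef := by
  refine Matrix.PosDef.of_dotProduct_mulVec_pos ?_ fun x hx => ?_
  · ext i j
    fin_cases i <;> fin_cases j <;> simp
  · have hform : star x ⬝ᵥ (!![a, b; b, d] *ᵥ x)
        = a * x 0 ^ 2 + 2 * b * x 0 * x 1 + d * x 1 ^ 2 := by
      simp [dotProduct, mulVec, Fin.sum_univ_two]
      ring
    rw [hform]
    refine pos_of_mul_pos_right (a := a) ?_ ha.le
    have hsq : a * (a * x 0 ^ 2 + 2 * b * x 0 * x 1 + d * x 1 ^ 2)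
        = (a * x 0 + b * x 1) ^ 2 + (a * d - b ^ 2) * x 1 ^ 2 := by ring
    rw [hsq]
    have hgap : 0 < a * d - b ^ 2 := sub_pos.mpr hdet
    by_cases h1 : x 1 = 0
    · have h0 : x 0 ≠ 0 := fun h0 => hx <| by
        ext i
        fin_cases i <;> simp [h0, h1]
      rw [h1]
      have : 0 < (a * x 0) ^ 2 := by positivity
      linarith
    · positivity

/-- The symmetric matrix `P` with the stated entries is positive definite,
solves the Lyapunov equation `P(A+BK) + (A+BK)ᵀP = −Q` with `Q = λ diag(1, κ)`, and
`D = −(2/α) P B = (λβ/α)[1/c, ε/(c(1+cε)) + κ/(1+cε)]ᵀ`. -/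
theorem lyapunov_matrix_solution
    (α ε β c lam κ : ℝ)
    (hα : 0 < α) (hε : 0 < ε) (hβ : 0 < β) (hc : 0 < c) (hlam : 0 < lam) (hκ : 0 ≤ κ)
    (A : Matrix (Fin 2) (Fin 2) ℝ) (hA : A = !![0, 1; 0, -1 / ε])
    (B : Matrix (Fin 2) (Fin 1) ℝ) (hB : B = !![0; -β / ε])
    (K : Matrix (Fin 1) (Fin 2) ℝ) (hK : K = (c / β) • !![1, ε])
    (Q : Matrix (Fin 2) (Fin 2) ℝ) (hQ : Q = lam • !![1, 0; 0, κ])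
    (p₁₂ p₂₂ p₁₁ : ℝ)
    (hp₁₂ : p₁₂ = lam * ε / (2 * c))
    (hp₂₂ : p₂₂ = (lam * ε / 2) * (ε / c + κ) / (1 + c * ε))
    (hp₁₁ : p₁₁ = p₁₂ * (1 + c * ε) / ε + c * p₂₂ / ε)
    (P : Matrix (Fin 2) (Fin 2) ℝ) (hP : P = !![p₁₁, p₁₂; p₁₂, p₂₂])
    (D : Matrix (Fin 2) (Fin 1) ℝ) (hD : D = (-(2 / α)) • (P * B)) :
    P.PosDef ∧
    P * (A + B * K) + (A + B * K)ᵀ * P = -Q ∧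
    D = (lam * β / α) • !![1 / c; ε / (c * (1 + c * ε)) + κ / (1 + c * ε)] := by
  have hs : 0 < 1 + c * ε := by positivity
  have h12 : 0 < p₁₂ := by rw [hp₁₂]; positivity
  have h22 : 0 < p₂₂ := by rw [hp₂₂]; positivity
  have h11 : 0 < p₁₁ := by rw [hp₁₁]; positivity
  refine ⟨?_, ?_, ?_⟩
  · rw [hP]
    refine posDef_fin_two_of_pos_of_sq_lt h11 ?_
    have hdet : p₁₁ * p₂₂ - p₁₂ ^ 2 = p₁₂ * lam * κ / 2 + c * p₂₂ ^ 2 / ε := by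
      rw [hp₁₁, hp₂₂, hp₁₂]
      field_simp
      ring
    have : 0 < p₁₂ * lam * κ / 2 + c * p₂₂ ^ 2 / ε := by positivity
    linarith
  · subst hA hB hK hQ hP hp₁₁ hp₂₂ hp₁₂
    ext i j
    fin_cases i <;> fin_cases j <;>
      simp [Matrix.mul_apply, Fin.sum_univ_two] <;> field_simp <;> ring
  · subst hB hP hD hp₁₁ hp₂₂ hp₁₂
    ext i j
    fin_cases i <;> fin_cases j <;>
      simp <;> field_simp
end

section
/- For all real x₁, x₂ with |x₁| ≤ s̄_r and |x₂| ≤ s̄_r, the two series Σ_{n≥0} b_{n+1} x_i^n / n! converge absolutely and |Σ_{n≥0} (b_{n+1}/n!)(x₁^n − x₂^n)| ≤ (2 M F G R / (R − F s̄_r)³) |x₁ − x₂|. (Applied with b_n = a_n(t), x₁ = −s_r(t) − η, x₂ = −s_r(t), this is the bound |d(e₁ᵀX)| ≤ 2MFGR(R − F s̄_r)^{−3}|X| on the residual boundary term in the target system.) -/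
/-- Factorial bounds on `b` turn into geometric bounds on the coefficients `b (n + 1) / n!`. -/
theorem abs_succ_div_factorial_le {M G F R : ℝ} {b : ℕ → ℝ}
    (hb : ∀ n : ℕ, |b n| ≤ M * G * F ^ ((n : ℤ) - 1) * (n.factorial : ℝ) / R ^ n) (n : ℕ) :
    |b (n + 1) / (n.factorial : ℝ)| ≤ M * G / R * ((n + 1) * (F / R) ^ n) := by
  have hn : (0 : ℝ) < n.factorial := by positivity
  rw [abs_div, abs_of_pos hn, div_le_iff₀ hn]
  refine (hb (n + 1)).trans_eq ?_
  have hz : ((n + 1 : ℕ) : ℤ) - 1 = n := by push_cast; ring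
  rw [hz, zpow_natCast, Nat.factorial_succ, div_pow, pow_succ R]
  push_cast
  simp only [div_eq_mul_inv, mul_inv]
  ring

/-- The sum of the second derivatives of `r ^ (n + 1)`. -/
theorem hasSum_succ_mul_mul_geometric {r : ℝ} (hr : |r| < 1) :
    HasSum (fun n : ℕ => ((n : ℝ) + 1) * n * r ^ (n - 1)) (2 / (1 - r) ^ 3) := by
  have h := (hasSum_choose_mul_geometric_of_norm_lt_one 2 (r := r) hr).mul_left 2
  rw [← hasSum_nat_add_iff' 1]
  convert! h using 1
  · funext n
    rw [Nat.cast_choose_two]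
    push_cast
    ring
  · norm_num [div_eq_mul_inv]

/-- For all `x₁, x₂` with `|x₁| ≤ s̄_r` and `|x₂| ≤ s̄_r`, the two series
`Σ_{n≥0} b_{n+1} x_i^n / n!` converge absolutely and
`|Σ_{n≥0} (b_{n+1}/n!)(x₁^n − x₂^n)| ≤ (2 M F G R / (R − F s̄_r)³) |x₁ − x₂|`. -/
theorem residual_boundary_term_bound
    (M G F R sbar_r : ℝ)
    (hM : 0 < M) (hG : 0 < G) (hF : 0 < F) (hR : 0 < R) (hsbar_r : 0 < sbar_r)
    (hFs : F * sbar_r < R)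
    (b : ℕ → ℝ)
    (hb : ∀ n : ℕ, |b n| ≤ M * G * F ^ ((n : ℤ) - 1) * (n.factorial : ℝ) / R ^ n) :
    ∀ x₁ x₂ : ℝ, |x₁| ≤ sbar_r → |x₂| ≤ sbar_r →
      Summable (fun n : ℕ => |b (n + 1) * x₁ ^ n / (n.factorial : ℝ)|) ∧
      Summable (fun n : ℕ => |b (n + 1) * x₂ ^ n / (n.factorial : ℝ)|) ∧
      |∑' n : ℕ, (b (n + 1) / (n.factorial : ℝ)) * (x₁ ^ n - x₂ ^ n)| ≤
        (2 * M * F * G * R / (R - F * sbar_r) ^ 3) * |x₁ - x₂| := by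
  set r : ℝ := F * sbar_r / R with hr
  have hr0 : 0 ≤ r := by positivity
  have hr1 : |r| < 1 := by rwa [abs_of_nonneg hr0, hr, div_lt_one hR]
  have hsum : ∀ x : ℝ, |x| ≤ sbar_r →
      Summable (fun n : ℕ => |b (n + 1) * x ^ n / (n.factorial : ℝ)|) := by
    intro x hx
    have hg := (summable_choose_mul_geometric_of_norm_lt_one (R := ℝ) 1 hr1).mul_left (M * G / R)
    refine Summable.of_nonneg_of_le (fun n => abs_nonneg _) (fun n => ?_) hg
    calc |b (n + 1) * x ^ n / (n.factorial : ℝ)|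
        = |b (n + 1) / (n.factorial : ℝ)| * |x| ^ n := by
          rw [mul_div_right_comm, abs_mul, abs_pow]
      _ ≤ M * G / R * ((n + 1) * (F / R) ^ n) * sbar_r ^ n := by
          gcongr
          exact abs_succ_div_factorial_le hb n
      _ = M * G / R * (((n + 1).choose 1 : ℝ) * r ^ n) := by
          rw [hr, mul_div_right_comm F, mul_pow, Nat.choose_one_right]
          push_cast
          ring
  intro x₁ x₂ h₁ h₂
  refine ⟨hsum x₁ h₁, hsum x₂ h₂, ?_⟩
  have hmaj := (hasSum_succ_mul_mul_geometric hr1).mul_left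
    (M * G / R * (F / R) * |x₁ - x₂|)
  have hconst : M * G / R * (F / R) * |x₁ - x₂| * (2 / (1 - r) ^ 3) =
      2 * M * F * G * R / (R - F * sbar_r) ^ 3 * |x₁ - x₂| := by
    have hpos : R - F * sbar_r ≠ 0 := (sub_pos.2 hFs).ne'
    have hr' : 1 - r = (R - F * sbar_r) / R := by rw [hr]; field_simp
    rw [hr']
    field_simp
  rw [← hconst, ← Real.norm_eq_abs (∑' _, _)]
  refine tsum_of_norm_bounded hmaj fun n => ?_
  rw [Real.norm_eq_abs, abs_mul]
  calc |b (n + 1) / (n.factorial : ℝ)| * |x₁ ^ n - x₂ ^ n|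
      ≤ M * G / R * ((n + 1) * (F / R) ^ n) * (|x₁ - x₂| * n * sbar_r ^ (n - 1)) := by
        gcongr
        · exact abs_succ_div_factorial_le hb n
        · refine (abs_pow_sub_pow_le x₁ x₂ n).trans ?_
          gcongr
          exact max_le h₁ h₂
    _ = M * G / R * (F / R) * |x₁ - x₂| * (((n : ℝ) + 1) * n * r ^ (n - 1)) := by
        cases n with
        | zero => simp
        | succ k =>
          rw [hr, mul_div_right_comm F, mul_pow, Nat.add_sub_cancel, pow_succ (F / R)]
          ring
end

section
/- Let n ≥ 2 be an integer and let f, g : ℝ → ℝ be infinitely differentiable functions satisfying |f^{(m)}(t)| ≤ M F^{n−3} G H_{n−2,m} and |g^{(m)}(t)| ≤ M F^{n−2} G H_{n−1,m} for all integers m ≥ 0 and all t ≥ 0. Then the function h(t) := (ḟ(t) − ṡ_r(t) g(t))/α satisfies |h^{(m)}(t)| ≤ M F^{n−3} G H_{n,m} (R/α)((1 − 1/n) + MF/n) for all integers m ≥ 0 and all t ≥ 0. -/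
open Finset

/-- A weighted form of the hockey-stick identity:
`∑ k, C(m,k) k! (q+m-k)! = (q+m+1)!/(q+1)`. -/
theorem succ_mul_sum_choose_mul_factorial_mul_factorial (q m : ℕ) :
    (q + 1) * ∑ k ∈ range (m + 1), m.choose k * k.factorial * (q + (m - k)).factorial =
      (q + 1 + m).factorial := by
  induction m with
  | zero => simp [Nat.factorial_succ]
  | succ m ih =>
    rw [sum_range_succ']
    have hterm : ∀ k ∈ range (m + 1),
        (m + 1).choose (k + 1) * (k + 1).factorial * (q + (m + 1 - (k + 1))).factorial =
          (m + 1) * (m.choose k * k.factorial * (q + (m - k)).factorial) := by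
      intro k _
      have hk := Nat.add_one_mul_choose_eq m k
      rw [Nat.add_sub_add_right, Nat.factorial_succ k]
      simp only [← mul_assoc, hk]
    rw [sum_congr rfl hterm, ← mul_sum, mul_add, mul_left_comm, ih,
      show q + 1 + (m + 1) = (q + 1 + m) + 1 by ring, Nat.factorial_succ (q + 1 + m)]
    simp only [Nat.choose_zero_right, Nat.factorial_zero, Nat.sub_zero, one_mul,
      show q + (m + 1) = q + 1 + m by ring]
    ring

/-- For nonnegative reals and `1 ≤ d`, the sum of `d`-th powers is at most the `d`-th power of
the sum. -/
theorem sum_rpow_le_rpow_sum {ι : Type*} (s : Finset ι) (x : ι → ℝ) (hx : ∀ i ∈ s, 0 ≤ x i)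
    {d : ℝ} (hd : 1 ≤ d) : ∑ i ∈ s, x i ^ d ≤ (∑ i ∈ s, x i) ^ d := by
  have hsplit : ∀ y : ℝ, 0 ≤ y → y ^ d = y * y ^ (d - 1) := by
    intro y hy
    rw [← Real.rpow_one_add' hy (by linarith)]
    congr 1
    ring
  rw [hsplit _ (sum_nonneg hx), sum_mul]
  refine sum_le_sum fun i hi => ?_
  rw [hsplit _ (hx i hi)]
  exact mul_le_mul_of_nonneg_left
    (Real.rpow_le_rpow (hx i hi) (single_le_sum hx hi) (by linarith)) (hx i hi)

theorem sum_choose_mul_factorial_rpow_le (q m : ℕ) {d : ℝ} (hd : 1 ≤ d) :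
    ∑ k ∈ range (m + 1),
        (m.choose k : ℝ) * (k.factorial : ℝ) ^ d * ((q + (m - k)).factorial : ℝ) ^ d ≤
      ((q + 1 + m).factorial : ℝ) ^ d / ((q : ℝ) + 1) ^ d := by
  have hsum : ∑ k ∈ range (m + 1),
      (m.choose k : ℝ) * (k.factorial : ℝ) * ((q + (m - k)).factorial : ℝ) =
        ((q + 1 + m).factorial : ℝ) / ((q : ℝ) + 1) := by
    rw [eq_div_iff (by positivity), mul_comm]
    exact_mod_cast succ_mul_sum_choose_mul_factorial_mul_factorial q m
  rw [← Real.div_rpow (by positivity) (by positivity), ← hsum]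
  refine le_trans (sum_le_sum fun k hk => ?_)
    (sum_rpow_le_rpow_sum _ _ (fun k _ => by positivity) hd)
  rw [Real.mul_rpow (by positivity) (by positivity), Real.mul_rpow (by positivity) (by positivity)]
  gcongr
  refine Real.self_le_rpow_of_one_le ?_ hd
  exact_mod_cast Nat.choose_pos (Nat.lt_succ_iff.mp (mem_range.mp hk))

theorem factorial_rpow_div_le_shift {R d : ℝ} (hR : 0 < R) (hd : d ∈ Set.Icc (1 : ℝ) 2)
    (p m : ℕ) :
    ((p + (m + 1)).factorial : ℝ) ^ d / (R ^ (p + (m + 1)) * (p.factorial : ℝ) ^ (d - 1)) ≤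
      ((p + 2 + m).factorial : ℝ) ^ d /
        (R ^ (p + 2 + m) * ((p + 2).factorial : ℝ) ^ (d - 1)) *
          (R * (1 - 1 / ((p : ℝ) + 2))) := by
  obtain ⟨hd1, hd2⟩ := hd
  have hkey : ((p : ℝ) + 2) ^ (d - 1) * (p + 2) * ((p : ℝ) + 1) ^ (d - 1) ≤
      ((p : ℝ) + 2 + m) ^ d * (p + 1) := by
    have h1 : ((p : ℝ) + 2) ^ (d - 1) * (p + 2) = ((p : ℝ) + 2) ^ d := by
      rw [← Real.rpow_add_one (by positivity)]
      congr 1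
      ring
    rw [h1]
    have h2 : ((p : ℝ) + 1) ^ (d - 1) ≤ p + 1 :=
      Real.rpow_le_self_of_one_le (by linarith [(Nat.cast_nonneg p : (0 : ℝ) ≤ p)]) (by linarith)
    have h3 : ((p : ℝ) + 2) ^ d ≤ ((p : ℝ) + 2 + m) ^ d :=
      Real.rpow_le_rpow (by positivity) (by linarith [(Nat.cast_nonneg m : (0 : ℝ) ≤ m)])
        (by linarith)
    gcongr
  have hnum : ((p + 2 + m).factorial : ℝ) ^ d =
      ((p : ℝ) + 2 + m) ^ d * ((p + (m + 1)).factorial : ℝ) ^ d := by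
    rw [← Real.mul_rpow (by positivity) (by positivity),
      show p + 2 + m = (p + (m + 1)) + 1 by ring, Nat.factorial_succ]
    push_cast
    ring_nf
  have hden : ((p + 2).factorial : ℝ) ^ (d - 1) =
      ((p : ℝ) + 2) ^ (d - 1) * ((p : ℝ) + 1) ^ (d - 1) * (p.factorial : ℝ) ^ (d - 1) := by
    rw [← Real.mul_rpow (by positivity) (by positivity),
      ← Real.mul_rpow (by positivity) (by positivity), Nat.factorial_succ, Nat.factorial_succ]
    push_cast
    ring_nf
  have hp : 1 - 1 / ((p : ℝ) + 2) = (p + 1) / (p + 2) := by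
    field_simp
    ring
  rw [hnum, hden, hp, show p + 2 + m = (p + (m + 1)) + 1 by ring, pow_succ]
  have hrw : ((p : ℝ) + 2 + m) ^ d * ((p + (m + 1)).factorial : ℝ) ^ d /
        (R ^ (p + (m + 1)) * R * (((p : ℝ) + 2) ^ (d - 1) * ((p : ℝ) + 1) ^ (d - 1) *
          (p.factorial : ℝ) ^ (d - 1))) * (R * ((p + 1) / (p + 2))) =
      ((p + (m + 1)).factorial : ℝ) ^ d / (R ^ (p + (m + 1)) * (p.factorial : ℝ) ^ (d - 1)) *
        ((((p : ℝ) + 2 + m) ^ d * (p + 1)) /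
          (((p : ℝ) + 2) ^ (d - 1) * (p + 2) * ((p : ℝ) + 1) ^ (d - 1))) := by
    field_simp
  rw [hrw]
  refine le_mul_of_one_le_right (by positivity) ?_
  rw [one_le_div (by positivity)]
  exact hkey

theorem sum_choose_mul_factorial_rpow_div_le {M R d : ℝ} (hM : 0 < M) (hR : 0 < R) (hd : 1 ≤ d)
    (p m : ℕ) :
    ∑ k ∈ range (m + 1), (m.choose k : ℝ) * (M * (k.factorial : ℝ) ^ d / R ^ k) *
        (((p + 1 + (m - k)).factorial : ℝ) ^ d /
          (R ^ (p + 1 + (m - k)) * ((p + 1).factorial : ℝ) ^ (d - 1))) ≤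
      ((p + 2 + m).factorial : ℝ) ^ d /
        (R ^ (p + 2 + m) * ((p + 2).factorial : ℝ) ^ (d - 1)) * (R * (M / ((p : ℝ) + 2))) := by
  have hterm : ∀ k ∈ range (m + 1), (m.choose k : ℝ) * (M * (k.factorial : ℝ) ^ d / R ^ k) *
        (((p + 1 + (m - k)).factorial : ℝ) ^ d /
          (R ^ (p + 1 + (m - k)) * ((p + 1).factorial : ℝ) ^ (d - 1))) =
      M / (R ^ (p + 1 + m) * ((p + 1).factorial : ℝ) ^ (d - 1)) *
        ((m.choose k : ℝ) * (k.factorial : ℝ) ^ d * ((p + 1 + (m - k)).factorial : ℝ) ^ d) := by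
    intro k hk
    have hkm : k ≤ m := Nat.lt_succ_iff.mp (mem_range.mp hk)
    have hpow : R ^ (p + 1 + m) = R ^ k * R ^ (p + 1 + (m - k)) := by
      rw [← pow_add]
      congr 1
      omega
    rw [hpow]
    field_simp
  have hden : ((p + 2).factorial : ℝ) ^ (d - 1) =
      ((p : ℝ) + 2) ^ (d - 1) * ((p + 1).factorial : ℝ) ^ (d - 1) := by
    rw [← Real.mul_rpow (by positivity) (by positivity), Nat.factorial_succ (p + 1)]
    push_cast
    ring_nf
  have hsplit : ((p : ℝ) + 2) ^ d = ((p : ℝ) + 2) ^ (d - 1) * (p + 2) := by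
    rw [← Real.rpow_add_one (by positivity)]
    congr 1
    ring
  have hsum := sum_choose_mul_factorial_rpow_le (p + 1) m hd
  rw [show ((p + 1 : ℕ) : ℝ) + 1 = p + 2 by push_cast; ring, hsplit] at hsum
  rw [sum_congr rfl hterm, ← mul_sum]
  refine (mul_le_mul_of_nonneg_left hsum (by positivity)).trans_eq ?_
  rw [hden, show p + 2 + m = (p + 1 + m) + 1 by ring, pow_succ]
  field_simp


/-- The induction step of Proposition 1: if `f` and `g` satisfy the
coefficient bounds at levels `n−2` and `n−1` respectively, then
`h(t) = (ḟ(t) − ṡ_r(t) g(t))/α` satisfies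
`|h^{(m)}(t)| ≤ M F^(n−3) G H_{n,m} (R/α)((1 − 1/n) + MF/n)`. -/
theorem coefficient_induction_step
    (α β ε M R d : ℝ)
    (hα : 0 < α) (hβ : 0 < β) (hε : 0 < ε) (hM : 0 < M) (hR : 0 < R)
    (hd : d ∈ Set.Icc (1 : ℝ) 2)
    (s_r : ℝ → ℝ) (hs : ContDiff ℝ (⊤ : ℕ∞) s_r)
    (hGevrey : ∀ (m : ℕ) (t : ℝ), 0 ≤ t →
      |iteratedDeriv (m + 1) s_r t| ≤ M * (m.factorial : ℝ) ^ d / R ^ m)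
    (G F : ℝ)
    (hG : G = (ε + R) / β)
    (hF : F = (R * M + Real.sqrt (R ^ 2 * M ^ 2 + 16 * α * R)) / (4 * α))
    (H : ℕ → ℕ → ℝ)
    (hH : ∀ n m : ℕ,
      H n m = ((n + m).factorial : ℝ) ^ d / (R ^ (n + m) * (n.factorial : ℝ) ^ (d - 1)))
    (n : ℕ) (hn : 2 ≤ n)
    (f g : ℝ → ℝ) (hf : ContDiff ℝ (⊤ : ℕ∞) f) (hg : ContDiff ℝ (⊤ : ℕ∞) g)
    (hfb : ∀ (m : ℕ) (t : ℝ), 0 ≤ t →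
      |iteratedDeriv m f t| ≤ M * F ^ ((n : ℤ) - 3) * G * H (n - 2) m)
    (hgb : ∀ (m : ℕ) (t : ℝ), 0 ≤ t →
      |iteratedDeriv m g t| ≤ M * F ^ ((n : ℤ) - 2) * G * H (n - 1) m)
    (h : ℝ → ℝ)
    (hh : ∀ t : ℝ, h t = (deriv f t - deriv s_r t * g t) / α) :
    ∀ (m : ℕ) (t : ℝ), 0 ≤ t →
      |iteratedDeriv m h t| ≤ M * F ^ ((n : ℤ) - 3) * G * H n m *
        ((R / α) * ((1 - 1 / (n : ℝ)) + M * F / (n : ℝ))) := by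
  intro m t ht
  obtain ⟨p, rfl⟩ := Nat.exists_eq_add_of_le' hn
  have hGpos : 0 < G := by rw [hG]; positivity
  have hFpos : 0 < F := by rw [hF]; positivity
  have hf' : ContDiff ℝ (⊤ : ℕ∞) (deriv f) := (contDiff_infty_iff_deriv.mp hf).2
  have hs' : ContDiff ℝ (⊤ : ℕ∞) (deriv s_r) := (contDiff_infty_iff_deriv.mp hs).2
  have hle : ∀ j : ℕ, (j : WithTop ℕ∞) ≤ ((⊤ : ℕ∞) : WithTop ℕ∞) := fun j => by
    exact_mod_cast le_top
  have hderiv : iteratedDeriv m h t = (iteratedDeriv (m + 1) f t -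
      ∑ k ∈ range (m + 1),
        m.choose k * iteratedDeriv (k + 1) s_r t * iteratedDeriv (m - k) g t) / α := by
    rw [funext hh, iteratedDeriv_div_const,
      iteratedDeriv_fun_sub (hf'.contDiffAt.of_le (hle m))
        ((hs'.mul hg).contDiffAt.of_le (hle m)),
      iteratedDeriv_fun_mul (hs'.contDiffAt.of_le (hle m)) (hg.contDiffAt.of_le (hle m))]
    simp only [← iteratedDeriv_succ']
  set P := M * F ^ (((p + 2 : ℕ) : ℤ) - 3) * G with hP
  have hPpos : 0 < P := by positivity
  have hzpow : M * F ^ (((p + 2 : ℕ) : ℤ) - 2) * G = P * F := by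
    rw [hP, show (((p + 2 : ℕ) : ℤ) - 2) = (((p + 2 : ℕ) : ℤ) - 3) + 1 by ring,
      zpow_add_one₀ hFpos.ne']
    ring
  have hfirst : |iteratedDeriv (m + 1) f t| ≤
      P * (H (p + 2) m * (R * (1 - 1 / ((p : ℝ) + 2)))) := by
    refine (hfb (m + 1) t ht).trans (mul_le_mul_of_nonneg_left ?_ hPpos.le)
    rw [hH, hH, Nat.add_sub_cancel]
    exact factorial_rpow_div_le_shift hR hd p m
  have hsecond : |∑ k ∈ range (m + 1),
      m.choose k * iteratedDeriv (k + 1) s_r t * iteratedDeriv (m - k) g t| ≤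
        P * F * (H (p + 2) m * (R * (M / ((p : ℝ) + 2)))) := by
    calc |∑ k ∈ range (m + 1),
          m.choose k * iteratedDeriv (k + 1) s_r t * iteratedDeriv (m - k) g t|
        ≤ ∑ k ∈ range (m + 1),
          |m.choose k * iteratedDeriv (k + 1) s_r t * iteratedDeriv (m - k) g t| :=
          abs_sum_le_sum_abs _ _
      _ ≤ ∑ k ∈ range (m + 1), P * F * ((m.choose k : ℝ) *
            (M * (k.factorial : ℝ) ^ d / R ^ k) * H (p + 1) (m - k)) := by
          refine sum_le_sum fun k _ => ?_
          have hgk := hgb (m - k) t ht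
          rw [hzpow, show p + 2 - 1 = p + 1 by omega] at hgk
          rw [abs_mul, abs_mul, Nat.abs_cast]
          calc (m.choose k : ℝ) * |iteratedDeriv (k + 1) s_r t| * |iteratedDeriv (m - k) g t|
              ≤ (m.choose k : ℝ) * (M * (k.factorial : ℝ) ^ d / R ^ k) *
                  (P * F * H (p + 1) (m - k)) := by
                gcongr
                exact hGevrey k t ht
            _ = _ := by ring
      _ ≤ _ := by
          rw [← mul_sum]
          refine mul_le_mul_of_nonneg_left ?_ (by positivity)
          simp only [hH]
          exact sum_choose_mul_factorial_rpow_div_le hM hR hd.1 p m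
  rw [hderiv, abs_div, abs_of_pos hα, div_le_iff₀ hα]
  refine ((abs_sub _ _).trans (add_le_add hfirst hsecond)).trans_eq ?_
  push_cast
  field_simp
end
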